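/- The identity ∑_{n=1}^∞ (10n² − 6n + 1)·(−256)ⁿ / (n⁵ · C(2n,n)⁵) = −28ζ(3) holds, where C(2n,n) is the central binomial coefficient. -/

import Mathlib

open Finset Filter Topology

/-- The product `(k + 1/2)(k + 3/2) ⋯ (k + n + 1/2)`. -/
noncomputable def halfShiftProd (n k : ℕ) : ℝ :=
  ∏ i ∈ range (n + 1), ((k : ℝ) + i + 1 / 2)

/-- The common hypergeometric factor of the Wilf–Zeilberger pair. -/
noncomputable def wzKernel (n k : ℕ) : ℝ :=
  (-1) ^ n * ((n.factorial : ℝ) ^ 6 / ((2 * n).factorial : ℝ)) / halfShiftProd n k ^ 4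

/-- The component of the Wilf–Zeilberger pair that is summed over `k`. -/
noncomputable def wzF (n k : ℕ) : ℝ := wzKernel n k * (2 * k + 1 + n)

/-- The component of the Wilf–Zeilberger pair that is summed over `n`. -/
noncomputable def wzG (n k : ℕ) : ℝ :=
  wzKernel n k *
    ((4 * (k : ℝ) ^ 2 + 12 * k * n + 8 * k + 10 * (n : ℝ) ^ 2 + 14 * n + 5) / (4 * (2 * n + 1)))

lemma halfShiftProd_pos (n k : ℕ) : 0 < halfShiftProd n k :=
  prod_pos fun _ _ => by positivity

lemma halfShiftProd_succ_left (n k : ℕ) :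
    halfShiftProd (n + 1) k = halfShiftProd n k * (k + n + 3 / 2) := by
  rw [halfShiftProd, prod_range_succ, halfShiftProd]
  push_cast
  ring

lemma halfShiftProd_succ_right (n k : ℕ) :
    halfShiftProd n (k + 1) * (k + 1 / 2) = halfShiftProd n k * (k + n + 3 / 2) := by
  rw [← halfShiftProd_succ_left, halfShiftProd, halfShiftProd, prod_range_succ' _ (n + 1)]
  push_cast
  congr 1
  · exact prod_congr rfl fun i _ => by ring
  · ring

lemma le_halfShiftProd (n k : ℕ) : (n.factorial : ℝ) * (k + 1 / 2) ≤ halfShiftProd n k := by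
  induction n with
  | zero => simp [halfShiftProd]
  | succ n ih =>
    rw [halfShiftProd_succ_left, Nat.factorial_succ]
    push_cast
    calc ((n : ℝ) + 1) * n.factorial * (k + 1 / 2) = n.factorial * (k + 1 / 2) * (n + 1) := by ring
      _ ≤ halfShiftProd n k * (k + n + 3 / 2) := by
        have hk : (0 : ℝ) ≤ k := k.cast_nonneg
        exact mul_le_mul ih (by linarith) (by positivity) (halfShiftProd_pos n k).le

lemma halfShiftProd_zero_right (n : ℕ) :
    halfShiftProd n 0 * 4 ^ (n + 1) = (n + 1).factorial * (Nat.centralBinom (n + 1) : ℝ) := by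
  induction n with
  | zero => norm_num [halfShiftProd, Nat.centralBinom, Nat.choose]
  | succ n ih =>
    have h : ((n : ℝ) + 1 + 1) * Nat.centralBinom (n + 1 + 1) =
        2 * (2 * (n + 1) + 1) * Nat.centralBinom (n + 1) := by
      exact_mod_cast Nat.succ_mul_centralBinom_succ (n + 1)
    rw [halfShiftProd_succ_left, Nat.factorial_succ (n + 1)]
    push_cast
    linear_combination (4 * ((n : ℝ) + 3 / 2)) * ih - ((n + 1).factorial : ℝ) * h

lemma wzKernel_succ_left (n k : ℕ) :
    wzKernel (n + 1) k = -wzKernel n k *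
      (((n : ℝ) + 1) ^ 5 / (2 * (2 * n + 1)) / (k + n + 3 / 2) ^ 4) := by
  have hD := (halfShiftProd_pos n k).ne'
  have h2 : ((2 * n).factorial : ℝ) ≠ 0 := by positivity
  rw [wzKernel, wzKernel, halfShiftProd_succ_left, show 2 * (n + 1) = 2 * n + 1 + 1 by ring,
    Nat.factorial_succ, Nat.factorial_succ, Nat.factorial_succ]
  push_cast
  field_simp
  ring

lemma wzKernel_succ_right (n k : ℕ) :
    wzKernel n (k + 1) = wzKernel n k * (((k : ℝ) + 1 / 2) ^ 4 / (k + n + 3 / 2) ^ 4) := by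
  have hD := (halfShiftProd_pos n k).ne'
  have h : halfShiftProd n (k + 1) = halfShiftProd n k * (k + n + 3 / 2) / (k + 1 / 2) := by
    rw [eq_div_iff (by positivity), halfShiftProd_succ_right]
  rw [wzKernel, wzKernel, h]
  field_simp

lemma wzF_sub_wzF_succ (n k : ℕ) : wzF n k - wzF (n + 1) k = wzG n k - wzG n (k + 1) := by
  rw [wzF, wzF, wzG, wzG, wzKernel_succ_left, wzKernel_succ_right]
  push_cast
  have h : (k : ℝ) + n + 3 / 2 ≠ 0 := by positivity
  have h' : 2 * (n : ℝ) + 1 ≠ 0 := by positivity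
  generalize wzKernel n k = t
  field_simp
  ring

lemma two_pow_mul_factorial_sq_le (n : ℕ) : 2 ^ n * n.factorial ^ 2 ≤ (2 * n).factorial := by
  induction n with
  | zero => simp
  | succ n ih =>
    rw [show 2 * (n + 1) = 2 * n + 1 + 1 by ring, Nat.factorial_succ (2 * n + 1),
      Nat.factorial_succ (2 * n), Nat.factorial_succ n]
    calc 2 ^ (n + 1) * ((n + 1) * n.factorial) ^ 2
        = (2 * n + 1 + 1) * ((n + 1) * (2 ^ n * n.factorial ^ 2)) := by ring
      _ ≤ (2 * n + 1 + 1) * ((2 * n + 1) * (2 * n).factorial) := by gcongr; omega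

lemma abs_wzKernel_le (n k : ℕ) : |wzKernel n k| ≤ (1 / 2) ^ n / ((k : ℝ) + 1 / 2) ^ 4 := by
  have hD := halfShiftProd_pos n k
  have hc : (2 : ℝ) ^ n * (n.factorial : ℝ) ^ 2 ≤ (2 * n).factorial := by
    exact_mod_cast two_pow_mul_factorial_sq_le n
  rw [wzKernel, abs_div, abs_mul, abs_pow, abs_neg, abs_one, one_pow, one_mul,
    abs_of_pos (by positivity), abs_of_pos (by positivity), div_div, one_div_pow, div_div, div_le_div_iff₀ (by positivity) (by positivity)]
  calc (n.factorial : ℝ) ^ 6 * (2 ^ n * ((k : ℝ) + 1 / 2) ^ 4)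
      = (2 ^ n * (n.factorial : ℝ) ^ 2) * (n.factorial * ((k : ℝ) + 1 / 2)) ^ 4 := by ring
    _ ≤ (2 * n).factorial * halfShiftProd n k ^ 4 := by
      gcongr
      exact le_halfShiftProd n k
    _ = 1 * ((2 * n).factorial * halfShiftProd n k ^ 4) := by ring

lemma abs_wzF_le (n k : ℕ) :
    |wzF n k| ≤ (n + 1) * (1 / 2) ^ n * (16 * (1 / (2 * (k : ℝ) + 1) ^ 3)) := by
  have hk : (0 : ℝ) ≤ k := k.cast_nonneg
  have hn : (0 : ℝ) ≤ n := n.cast_nonneg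
  rw [wzF, abs_mul, abs_of_nonneg (a := 2 * (k : ℝ) + 1 + n) (by positivity)]
  calc |wzKernel n k| * (2 * k + 1 + n)
      ≤ (1 / 2) ^ n / ((k : ℝ) + 1 / 2) ^ 4 * ((n + 1) * (2 * k + 1)) := by
        gcongr
        · exact abs_wzKernel_le n k
        · nlinarith [mul_nonneg hn hk]
    _ = _ := by
      rw [show (k : ℝ) + 1 / 2 = (2 * k + 1) / 2 by ring]
      field_simp
      ring

lemma abs_wzG_le (n k : ℕ) :
    |wzG n k| ≤ 20 * (n + 1) * (1 / 2) ^ n * (1 / ((k : ℝ) + 1 / 2) ^ 2) := by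
  have hk : (0 : ℝ) ≤ k := k.cast_nonneg
  have hn : (0 : ℝ) ≤ n := n.cast_nonneg
  rw [wzG, abs_mul, abs_of_nonneg (a := _ / _) (by positivity)]
  calc |wzKernel n k| * _
      ≤ (1 / 2) ^ n / ((k : ℝ) + 1 / 2) ^ 4 * (20 * (n + 1) * ((k : ℝ) + 1 / 2) ^ 2) := by
        gcongr
        · exact abs_wzKernel_le n k
        · rw [div_le_iff₀ (by positivity)]
          have hkn := mul_nonneg hk hn
          nlinarith [mul_nonneg hkn hn, mul_nonneg hkn hk, mul_nonneg hkn hkn, sq_nonneg (k : ℝ),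
            sq_nonneg (n : ℝ)]
    _ = _ := by
      field_simp

lemma summable_one_div_odd_cube : Summable fun k : ℕ => 1 / (2 * (k : ℝ) + 1) ^ 3 := by
  have h := (Real.summable_one_div_nat_pow (p := 3)).2 (by norm_num)
  have h' := h.comp_injective (i := fun k : ℕ => 2 * k + 1) fun a b hab => by
    simpa using hab
  simpa [Function.comp_def] using h'

lemma tsum_one_div_odd_cube :
    ∑' k : ℕ, 1 / (2 * (k : ℝ) + 1) ^ 3 = 7 / 8 * ∑' k : ℕ, 1 / ((k : ℝ) + 1) ^ 3 := by
  have h : Summable fun k : ℕ => 1 / ((k : ℝ) + 1) ^ 3 := by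
    have h' := (summable_nat_add_iff 1).2 ((Real.summable_one_div_nat_pow (p := 3)).2 (by norm_num))
    simpa using h'
  have e : ∀ k : ℕ, 1 / (((2 * k + 1 : ℕ) : ℝ) + 1) ^ 3 = 1 / 8 * (1 / ((k : ℝ) + 1) ^ 3) := by
    intro k
    push_cast
    rw [show 2 * (k : ℝ) + 1 + 1 = 2 * (k + 1) by ring]
    field_simp
    norm_num
  have o : ∀ k : ℕ, 1 / (((2 * k : ℕ) : ℝ) + 1) ^ 3 = 1 / (2 * (k : ℝ) + 1) ^ 3 := by
    intro k
    push_cast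
    rfl
  have key := tsum_even_add_odd (f := fun k : ℕ => 1 / ((k : ℝ) + 1) ^ 3)
    (by simpa only [o] using summable_one_div_odd_cube)
    (by simpa only [e] using h.mul_left (1 / 8))
  simp only [o, e, tsum_mul_left] at key
  linarith

lemma summable_wzF (n : ℕ) : Summable (wzF n) :=
  .of_norm_bounded ((summable_one_div_odd_cube.mul_left 16).mul_left _) (abs_wzF_le n)

lemma tendsto_wzG_atTop (n : ℕ) : Tendsto (wzG n) atTop (𝓝 0) := by
  have h : Tendsto (fun k : ℕ => 1 / ((k : ℝ) + 1 / 2) ^ 2) atTop (𝓝 0) := by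
    simp only [one_div]
    exact ((tendsto_pow_atTop two_ne_zero).comp
      (tendsto_atTop_add_const_right _ _ tendsto_natCast_atTop_atTop)).inv_tendsto_atTop
  exact squeeze_zero_norm (abs_wzG_le n) (by simpa using h.const_mul _)

lemma tsum_wzF_sub_tsum_wzF_succ (n : ℕ) :
    ∑' k, wzF n k - ∑' k, wzF (n + 1) k = wzG n 0 := by
  rw [← (summable_wzF n).tsum_sub (summable_wzF (n + 1))]
  refine tendsto_nhds_unique
    ((summable_wzF n).sub (summable_wzF (n + 1))).hasSum.tendsto_sum_nat ?_
  simp only [wzF_sub_wzF_succ, sum_range_sub']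
  simpa using (tendsto_wzG_atTop n).const_sub (wzG n 0)

lemma summable_succ_mul_half_pow : Summable fun n : ℕ => ((n : ℝ) + 1) * (1 / 2) ^ n := by
  have h := summable_pow_mul_geometric_of_norm_lt_one 1 (r := (1 / 2 : ℝ)) (by norm_num)
  simpa [add_mul] using h.add summable_geometric_two

lemma tendsto_tsum_wzF : Tendsto (fun n => ∑' k, wzF n k) atTop (𝓝 0) := by
  have hb (n : ℕ) := tsum_of_norm_bounded (f := wzF n)
    ((summable_one_div_odd_cube.mul_left 16).mul_left (((n : ℝ) + 1) * (1 / 2) ^ n)).hasSum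
    (abs_wzF_le n)
  refine squeeze_zero_norm hb ?_
  simp only [tsum_mul_left]
  simpa only [zero_mul] using summable_succ_mul_half_pow.tendsto_atTop_zero.mul_const
    (16 * ∑' k : ℕ, 1 / (2 * (k : ℝ) + 1) ^ 3)

lemma hasSum_wzG_zero : HasSum (fun n => wzG n 0) (∑' k, wzF 0 k) := by
  have hs : Summable fun n => wzG n 0 := by
    refine .of_norm_bounded (g := fun n : ℕ => 80 * (((n : ℝ) + 1) * (1 / 2) ^ n))
      (summable_succ_mul_half_pow.mul_left 80) fun n => (abs_wzG_le n 0).trans_eq ?_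
    push_cast
    ring
  refine hs.hasSum_iff_tendsto_nat.2 ?_
  simp only [← tsum_wzF_sub_tsum_wzF_succ, sum_range_sub']
  simpa using tendsto_tsum_wzF.const_sub (∑' k, wzF 0 k)

lemma wzF_zero_left (k : ℕ) : wzF 0 k = 16 * (1 / (2 * (k : ℝ) + 1) ^ 3) := by
  have h : 2 * (k : ℝ) + 1 ≠ 0 := by positivity
  simp only [wzF, wzKernel, halfShiftProd, zero_add, prod_range_one]
  rw [show (k : ℝ) + (0 : ℕ) + 1 / 2 = (2 * k + 1) / 2 by push_cast; ring]
  norm_num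
  field_simp
  norm_num

lemma neg_two_mul_wzG_zero (n : ℕ) :
    -2 * wzG n 0 = (10 * ((n : ℝ) + 1) ^ 2 - 6 * ((n : ℝ) + 1) + 1) * (-256 : ℝ) ^ (n + 1) /
      (((n : ℝ) + 1) ^ 5 * ((Nat.choose (2 * (n + 1)) (n + 1) : ℝ)) ^ 5) := by
  rw [← Nat.centralBinom_eq_two_mul_choose]
  have hC : (Nat.centralBinom (n + 1) : ℝ) ≠ 0 := by
    exact_mod_cast (Nat.centralBinom_pos (n + 1)).ne'
  have hn : (n.factorial : ℝ) ≠ 0 := by positivity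
  have hD : halfShiftProd n 0 = (n + 1) * n.factorial * Nat.centralBinom (n + 1) / 4 ^ (n + 1) := by
    rw [eq_div_iff (by positivity), halfShiftProd_zero_right, Nat.factorial_succ]
    push_cast
    ring
  have hF : ((2 * n).factorial : ℝ) =
      Nat.centralBinom (n + 1) * (n + 1) * (n.factorial : ℝ) ^ 2 / (2 * (2 * n + 1)) := by
    have h1 : ((n : ℝ) + 1) * Nat.centralBinom (n + 1) = 2 * (2 * n + 1) * Nat.centralBinom n := by
      exact_mod_cast Nat.succ_mul_centralBinom_succ n
    have h2 : (Nat.centralBinom n : ℝ) * n.factorial * n.factorial = (2 * n).factorial := by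
      have h := Nat.choose_mul_factorial_mul_factorial (show n ≤ 2 * n by omega)
      rw [show 2 * n - n = n by omega] at h
      exact_mod_cast h
    rw [eq_div_iff (by positivity), ← h2]
    linear_combination -(n.factorial : ℝ) ^ 2 * h1
  have hpow : (-256 : ℝ) ^ (n + 1) = -256 * ((-1) ^ n * (4 ^ n) ^ 4) := by
    rw [← pow_mul, mul_comm n 4, pow_mul, ← mul_pow]
    norm_num [pow_succ]
    ring
  rw [wzG, wzKernel, hD, hF, hpow]
  push_cast
  field_simp
  ring

/-- Guillera's identity in central-binomial form:
`∑_{n≥1} (10n²−6n+1)(−256)ⁿ/(n⁵ C(2n,n)⁵) = −28 ζ(3)`. -/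
theorem stmt_1 :
    ∑' n : ℕ,
      (10 * ((n : ℝ) + 1) ^ 2 - 6 * ((n : ℝ) + 1) + 1) * (-256 : ℝ) ^ (n + 1) /
        (((n : ℝ) + 1) ^ 5 * ((Nat.choose (2 * (n + 1)) (n + 1) : ℝ)) ^ 5)
      = -28 * ∑' k : ℕ, 1 / ((k : ℝ) + 1) ^ 3 := by
  simp only [← neg_two_mul_wzG_zero, tsum_mul_left, hasSum_wzG_zero.tsum_eq, wzF_zero_left,
    tsum_one_div_odd_cube]
  ring
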